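/- Let γ ∈ (0,1), let z_n = x₀ + η/n^γ with x₀ ∈ (−2,2), Im η ≠ 0, and set q_n = φ(z_n) where φ(ζ)=(ζ−√(ζ²−4))/2 maps ℂ∖[−2,2] into the open unit disk. Define g_n: [0,∞) → ℂ by g_n(x) = (q_n^{n^γ})^{x/n^γ} (principal branch). Then there exist d, D > 0 independent of n such that for all x ≥ 0: |g_n(x)| ≤ D·exp(−d·x/n^γ) and |g_n'(x)| ≤ (D·d/n^γ)·exp(−d·x/n^γ). -/

import Mathlib

theorem key_bound (q z : ℂ) (m : ℝ) (h : q * q - z * q + 1 = 0) (hq : ‖q‖ < 1) (hz : ‖z‖ ≤ 3)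
    (hm : z.re ^ 2 ≤ m ^ 2) (hm2 : 0 < 1 - m ^ 2 / 4) :
    q ≠ 0 ∧ Real.log ‖q‖ ≤ -(|z.im| / 8) ∧ -(8 * |z.im| / (1 - m ^ 2 / 4)) ≤ Real.log ‖q‖ := by
  have hq0 : q ≠ 0 := by
    rintro rfl
    simp at h
  have hr0 : 0 < ‖q‖ := norm_pos_iff.mpr hq0
  have hr4 : 1 / 4 ≤ ‖q‖ := by
    have h1 : (1 : ℂ) = q * (z - q) := by linear_combination h
    have h2 : (1 : ℝ) = ‖q‖ * ‖z - q‖ := by rw [← norm_mul, ← h1, norm_one]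
    have h3 : ‖z - q‖ ≤ 4 := (norm_sub_le _ _).trans (by linarith)
    nlinarith
  set r := ‖q‖ with hr
  obtain ⟨s, hs⟩ : ∃ s, s = r ^ 2 := ⟨_, rfl⟩
  have hsab : s = q.re ^ 2 + q.im ^ 2 := by
    rw [hs, hr, Complex.sq_norm, Complex.normSq_apply]; ring
  have hs0 : 1 / 16 ≤ s := by rw [hs]; nlinarith
  have hs1 : s < 1 := by rw [hs]; nlinarith
  have hre := congrArg Complex.re h
  have him := congrArg Complex.im h
  simp at hre him
  have e1 : s * z.im = -(q.im * (1 - s)) := by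
    rw [hsab]
    linear_combination q.im * hre - q.re * him
  have e2 : s * z.re = q.re * (1 + s) := by
    rw [hsab]
    linear_combination -q.re * hre - q.im * him
  have e1' : s * |z.im| = |q.im| * (1 - s) := by
    have := congrArg abs e1
    rwa [abs_neg, abs_mul, abs_mul, abs_of_pos (by linarith : 0 < s),
      abs_of_pos (by linarith : 0 < 1 - s)] at this
  have hb : s * (1 - m ^ 2 / 4) ≤ q.im ^ 2 := by
    have h1 : q.re ^ 2 * (1 + s) ^ 2 ≤ s ^ 2 * m ^ 2 := by
      rw [← mul_pow, ← e2, mul_pow]; gcongr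
    have h2 : q.re ^ 2 * (4 * s) ≤ q.re ^ 2 * (1 + s) ^ 2 := by
      gcongr; nlinarith [sq_nonneg (1 - s)]
    have h3 : q.re ^ 2 ≤ s * m ^ 2 / 4 := by
      have h4 : s * (4 * q.re ^ 2) ≤ s * (s * m ^ 2) := by nlinarith
      have := le_of_mul_le_mul_left h4 (by linarith)
      linarith
    linarith
  have hbs : |q.im| ^ 2 ≤ s := by rw [sq_abs, hsab]; nlinarith [sq_nonneg q.re]
  have hb1 : |q.im| ≤ 1 := by nlinarith [abs_nonneg q.im]
  have hbr : |q.im| ≤ r := Complex.abs_im_le_norm q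
  have hb2 : s * (1 - m ^ 2 / 4) ≤ |q.im| := by
    rw [← sq_abs q.im] at hb; nlinarith [abs_nonneg q.im]
  have hlog : Real.log s = 2 * Real.log r := by rw [hs, Real.log_pow]; norm_num
  have hspos : 0 < s := by linarith
  refine ⟨hq0, ?_, ?_⟩
  · have h1 := Real.log_le_sub_one_of_pos hspos
    have h2 : r * |z.im| ≤ 1 - s := by
      have h3 : r * (r * |z.im|) ≤ r * (1 - s) := by
        calc r * (r * |z.im|) = s * |z.im| := by rw [hs]; ring
          _ = |q.im| * (1 - s) := e1'
          _ ≤ r * (1 - s) := by gcongr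
      exact le_of_mul_le_mul_left h3 hr0
    have h4 : 1 / 4 * |z.im| ≤ r * |z.im| := by gcongr
    linarith
  · have h1 := Real.one_sub_inv_le_log_of_pos hspos
    have h2 : s * (1 - m ^ 2 / 4) * (1 - s) ≤ s * |z.im| := by
      rw [e1']; gcongr
    have h3 : (1 - m ^ 2 / 4) * (1 - s) ≤ |z.im| := by
      refine le_of_mul_le_mul_left ?_ hspos
      linarith
    have h4 : 1 - s ≤ |z.im| / (1 - m ^ 2 / 4) := by
      rw [le_div_iff₀ hm2]; linarith
    have h5 : s⁻¹ - 1 ≤ 16 * (1 - s) := by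
      have : s⁻¹ - 1 = s⁻¹ * (1 - s) := by field_simp
      rw [this]
      have : s⁻¹ ≤ 16 := by
        rw [inv_le_comm₀ hspos (by norm_num)]; linarith
      gcongr
    have h6 : 8 * |z.im| / (1 - m ^ 2 / 4) = 8 * (|z.im| / (1 - m ^ 2 / 4)) := by ring
    rw [h6]
    linarith

/-- with `q_n = φ(z_n)`, `z_n = x₀ + η/n^γ`, the interpolating function
`g_n(x) = (q_n^{n^γ})^{x/n^γ}` (principal branch) satisfies, for some `d, D > 0`
independent of `n`, `|g_n(x)| ≤ D·exp(-dx/n^γ)` and `|g_n'(x)| ≤ (Dd/n^γ)·exp(-dx/n^γ)`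
for all `x ≥ 0`. -/
theorem stmt12 (γ : ℝ) (hγ : γ ∈ Set.Ioo (0 : ℝ) 1) (x₀ : ℝ) (hx₀ : x₀ ∈ Set.Ioo (-2 : ℝ) 2)
    (η : ℂ) (hη : η.im ≠ 0)
    (φ : ℂ → ℂ)
    (hφ : ∀ ζ : ℂ, ζ ∉ {w : ℂ | w.im = 0 ∧ -2 ≤ w.re ∧ w.re ≤ 2} →
      φ ζ * φ ζ - ζ * φ ζ + 1 = 0 ∧ ‖φ ζ‖ < 1) :
    ∃ d D : ℝ, 0 < d ∧ 0 < D ∧ ∀ᶠ n : ℕ in Filter.atTop, ∀ x : ℝ, 0 ≤ x →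
      (‖((φ ((x₀ : ℂ) + η / (((n : ℝ) ^ γ : ℝ) : ℂ)) ^ ((((n : ℝ) ^ γ : ℝ) : ℂ)))
          ^ (((x / (n : ℝ) ^ γ : ℝ) : ℂ)))‖
        ≤ D * Real.exp (-d * x / (n : ℝ) ^ γ)) ∧
      (‖deriv (fun y : ℝ =>
            (φ ((x₀ : ℂ) + η / (((n : ℝ) ^ γ : ℝ) : ℂ)) ^ ((((n : ℝ) ^ γ : ℝ) : ℂ)))
              ^ (((y / (n : ℝ) ^ γ : ℝ) : ℂ))) x‖
        ≤ D * d / (n : ℝ) ^ γ * Real.exp (-d * x / (n : ℝ) ^ γ)) := by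
  obtain ⟨hx1, hx2⟩ := hx₀
  obtain ⟨m, hmdef⟩ : ∃ m, m = (|x₀| + 2) / 2 := ⟨_, rfl⟩
  have hxa : |x₀| < 2 := abs_lt.mpr ⟨hx1, hx2⟩
  have hm0 : |x₀| < m := by linarith
  have hmlt : m < 2 := by linarith
  have hmpos : 0 < m := lt_of_le_of_lt (abs_nonneg _) hm0
  have hc : 0 < 1 - m ^ 2 / 4 := by nlinarith
  have hηpos : 0 < |η.im| := abs_pos.mpr hη
  obtain ⟨d, hd⟩ : ∃ d, d = |η.im| / 8 := ⟨_, rfl⟩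
  obtain ⟨C, hC⟩ : ∃ C, C = 8 * |η.im| / (1 - m ^ 2 / 4) := ⟨_, rfl⟩
  have hdpos : 0 < d := by rw [hd]; positivity
  have hCpos : 0 < C := by rw [hC]; positivity
  have hπ := Real.pi_pos
  have hDd : (C + Real.pi) ≤ (1 + (C + Real.pi) / d) * d := by
    have : (1 + (C + Real.pi) / d) * d = d + (C + Real.pi) := by field_simp
    linarith
  refine ⟨d, 1 + (C + Real.pi) / d, hdpos, by positivity, ?_⟩
  have hN : Filter.Tendsto (fun n : ℕ => (n : ℝ) ^ γ) Filter.atTop Filter.atTop :=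
    (tendsto_rpow_atTop hγ.1).comp tendsto_natCast_atTop_atTop
  have ev2 := hN.eventually_ge_atTop (‖η‖ / (m - |x₀|))
  filter_upwards [hN.eventually_gt_atTop 0, ev2] with n hn0 hn
  generalize (n : ℝ) ^ γ = N at hn0 hn
  have hsmall : ‖η‖ / N ≤ m - |x₀| := by
    rw [div_le_iff₀ (by linarith)] at hn ⊢
    linarith
  obtain ⟨z, hz⟩ : ∃ z, z = (x₀ : ℂ) + η / (N : ℂ) := ⟨_, rfl⟩
  have hzn : ‖z‖ ≤ m := by
    rw [hz]
    refine (norm_add_le _ _).trans ?_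
    rw [norm_div, Complex.norm_real, Complex.norm_real, Real.norm_eq_abs, Real.norm_eq_abs,
      abs_of_pos hn0]
    linarith
  have hzim : z.im = η.im / N := by
    rw [hz]; simp [Complex.div_ofReal_im]
  have hzabs : |z.im| = |η.im| / N := by rw [hzim, abs_div, abs_of_pos hn0]
  have hzre : z.re ^ 2 ≤ m ^ 2 := by
    rw [← sq_abs]
    have := Complex.abs_re_le_norm z
    gcongr
    linarith
  rw [← hz]
  obtain ⟨hq1, hq2⟩ := hφ z (by
    rintro ⟨h, -⟩
    rw [hzim] at h
    exact (div_ne_zero hη hn0.ne') h)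
  obtain ⟨hq0, hu, hl⟩ := key_bound (φ z) z m hq1 hq2 (by linarith) hzre hc
  generalize φ z = q at hq0 hu hl
  obtain ⟨w, hw⟩ : ∃ w, w = q ^ (N : ℂ) := ⟨_, rfl⟩
  rw [← hw]
  have hw0 : w ≠ 0 := by
    rw [hw]; simp [Complex.cpow_eq_zero_iff, hq0]
  have hwn : ‖w‖ = ‖q‖ ^ N := by
    rw [hw, Complex.norm_cpow_real]
  have hwl : Real.log ‖w‖ = N * Real.log ‖q‖ := by
    rw [hwn, Real.log_rpow (norm_pos_iff.mpr hq0)]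
  have hlu : Real.log ‖w‖ ≤ -d := by
    rw [hwl]
    calc N * Real.log ‖q‖ ≤ N * (-(|z.im| / 8)) := by gcongr
      _ = -d := by rw [hzabs, hd]; field_simp
  have hll : -C ≤ Real.log ‖w‖ := by
    rw [hwl]
    calc -C = N * (-(8 * |z.im| / (1 - m ^ 2 / 4))) := by rw [hzabs, hC]; field_simp
      _ ≤ N * Real.log ‖q‖ := by gcongr
  have hlogw : ‖Complex.log w‖ ≤ C + Real.pi := by
    refine (Complex.norm_le_abs_re_add_abs_im _).trans ?_
    rw [Complex.log_re, Complex.log_im]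
    have h1 : |Real.log ‖w‖| ≤ C := abs_le.mpr ⟨hll, by linarith⟩
    have h2 := Complex.abs_arg_le_pi w
    linarith
  intro x hx
  have hg : ‖w ^ (((x / N : ℝ) : ℂ))‖ ≤ Real.exp (-d * x / N) := by
    rw [Complex.norm_cpow_real, Real.rpow_def_of_pos (norm_pos_iff.mpr hw0)]
    apply Real.exp_le_exp.mpr
    rw [mul_div_assoc]
    have : 0 ≤ x / N := by positivity
    gcongr
  refine ⟨?_, ?_⟩
  · refine hg.trans ?_
    have h1 : (1 : ℝ) ≤ 1 + (C + Real.pi) / d := by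
      have : 0 ≤ (C + Real.pi) / d := by positivity
      linarith
    exact le_mul_of_one_le_left (Real.exp_pos _).le h1
  · have hder : HasDerivAt (fun y : ℝ => w ^ (((y / N : ℝ) : ℂ)))
        (w ^ (((x / N : ℝ) : ℂ)) * Complex.log w * ((1 / N : ℝ) : ℂ)) x := by
      have h1 : HasDerivAt (fun y : ℝ => ((y / N : ℝ) : ℂ)) ((1 / N : ℝ) : ℂ) x :=
        ((hasDerivAt_id x).div_const N).ofReal_comp
      have h2 := (hasDerivAt_id (((x / N : ℝ) : ℂ))).const_cpow (c := w) (Or.inl hw0)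
      have h3 := HasDerivAt.comp x h2 h1
      simp only [mul_one, id] at h3
      exact h3
    rw [hder.deriv, norm_mul, norm_mul, Complex.norm_real, Real.norm_eq_abs,
      abs_of_pos (by positivity : 0 < 1 / N)]
    calc _ ≤ Real.exp (-d * x / N) * (C + Real.pi) * (1 / N) := by gcongr
      _ ≤ Real.exp (-d * x / N) * ((1 + (C + Real.pi) / d) * d) * (1 / N) := by gcongr
      _ = _ := by ring
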